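/- For every real a > 0: ∫_0^∞ e^{-y²/(4a²)} · sin y dy = 2a·e^{-a²} · ∫_0^a e^{w²} dw. -/

import Mathlib

open Real MeasureTheory

theorem integrable_exp_neg_mul_sq_mul_sin {b : ℝ} (hb : 0 < b) (t : ℝ) :
    Integrable fun y : ℝ => Real.exp (-b * y ^ 2) * Real.sin (t * y) := by
  refine (integrable_exp_neg_mul_sq hb).mono' (by fun_prop) (.of_forall fun y => ?_)
  rw [norm_mul, Real.norm_eq_abs, Real.norm_eq_abs, Real.abs_exp]
  exact mul_le_of_le_one_right (Real.exp_pos _).le (Real.abs_sin_le_one _)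

theorem norm_mul_exp_neg_mul_sq_mul_cos_le (b t y : ℝ) :
    ‖y * Real.exp (-b * y ^ 2) * Real.cos (t * y)‖ ≤ ‖y * Real.exp (-b * y ^ 2)‖ := by
  rw [norm_mul]
  exact mul_le_of_le_one_right (norm_nonneg _) (Real.abs_cos_le_one _)

theorem integrable_mul_exp_neg_mul_sq_mul_cos {b : ℝ} (hb : 0 < b) (t : ℝ) :
    Integrable fun y : ℝ => y * Real.exp (-b * y ^ 2) * Real.cos (t * y) :=
  (integrable_mul_exp_neg_mul_sq hb).norm.mono' (by fun_prop)
    (.of_forall fun y => norm_mul_exp_neg_mul_sq_mul_cos_le b t y)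

theorem hasDerivAt_integral_exp_neg_mul_sq_mul_sin {b : ℝ} (hb : 0 < b) (t : ℝ) :
    HasDerivAt (fun t => ∫ y in Set.Ioi (0 : ℝ), Real.exp (-b * y ^ 2) * Real.sin (t * y))
      (∫ y in Set.Ioi (0 : ℝ), y * Real.exp (-b * y ^ 2) * Real.cos (t * y)) t := by
  refine (hasDerivAt_integral_of_dominated_loc_of_deriv_le
    (F := fun t y => Real.exp (-b * y ^ 2) * Real.sin (t * y))
    (F' := fun t y => y * Real.exp (-b * y ^ 2) * Real.cos (t * y))
    (bound := fun y => ‖y * Real.exp (-b * y ^ 2)‖) Filter.univ_mem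
    (.of_forall fun s => by fun_prop) (integrable_exp_neg_mul_sq_mul_sin hb t).integrableOn
    (by fun_prop) (.of_forall fun y s _ => norm_mul_exp_neg_mul_sq_mul_cos_le b s y)
    (integrable_mul_exp_neg_mul_sq hb).norm.integrableOn (.of_forall fun y s _ => ?_)).2
  refine (((hasDerivAt_id' s).mul_const y).sin.const_mul (Real.exp (-b * y ^ 2))).congr_deriv ?_
  ring

theorem two_mul_integral_mul_exp_neg_mul_sq_mul_cos_add {b : ℝ} (hb : 0 < b) (t : ℝ) :
    2 * b * (∫ y in Set.Ioi (0 : ℝ), y * Real.exp (-b * y ^ 2) * Real.cos (t * y))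
      + t * (∫ y in Set.Ioi (0 : ℝ), Real.exp (-b * y ^ 2) * Real.sin (t * y)) = 1 := by
  have hc := ((integrable_mul_exp_neg_mul_sq_mul_cos hb t).const_mul (2 * b)).integrableOn
    (s := Set.Ioi (0 : ℝ))
  have hs := ((integrable_exp_neg_mul_sq_mul_sin hb t).const_mul t).integrableOn
    (s := Set.Ioi (0 : ℝ))
  rw [← integral_const_mul, ← integral_const_mul, ← integral_add hc hs]
  have hlim : Filter.Tendsto (fun y : ℝ => Real.exp (-b * y ^ 2)) Filter.atTop (nhds 0) :=
    Real.tendsto_exp_atBot.comp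
      ((Filter.tendsto_pow_atTop two_ne_zero).const_mul_atTop_of_neg (neg_neg_of_pos hb))
  have hlim' : Filter.Tendsto (fun y : ℝ => -(Real.exp (-b * y ^ 2) * Real.cos (t * y)))
      Filter.atTop (nhds 0) := by
    refine squeeze_zero_norm (fun y => ?_) hlim
    rw [norm_neg, norm_mul, Real.norm_eq_abs, Real.norm_eq_abs, Real.abs_exp]
    exact mul_le_of_le_one_right (Real.exp_pos _).le (Real.abs_cos_le_one _)
  refine (integral_Ioi_of_hasDerivAt_of_tendsto' (fun y _ => ?_) (hc.add hs) hlim').trans ?_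
  · have he := ((hasDerivAt_pow 2 y).const_mul (-b)).exp
    have hcos := ((hasDerivAt_id' y).const_mul t).cos
    refine (he.mul hcos).neg.congr_deriv ?_
    simp only [Pi.add_apply]
    push_cast
    ring
  · simp

theorem integral_exp_neg_mul_sq_mul_sin {b : ℝ} (hb : 0 < b) (t : ℝ) :
    ∫ y in Set.Ioi (0 : ℝ), Real.exp (-b * y ^ 2) * Real.sin (t * y)
      = Real.exp (-(t ^ 2 / (4 * b))) / (2 * b) *
        ∫ s in (0 : ℝ)..t, Real.exp (s ^ 2 / (4 * b)) := by
  have hderiv (s : ℝ) : HasDerivAt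
      (fun s => 2 * b * Real.exp (s ^ 2 / (4 * b)) *
        ∫ y in Set.Ioi (0 : ℝ), Real.exp (-b * y ^ 2) * Real.sin (s * y))
      (Real.exp (s ^ 2 / (4 * b))) s := by
    have he := ((hasDerivAt_pow 2 s).div_const (4 * b)).exp.const_mul (2 * b)
    refine (he.mul (hasDerivAt_integral_exp_neg_mul_sq_mul_sin hb s)).congr_deriv ?_
    have h := two_mul_integral_mul_exp_neg_mul_sq_mul_cos_add hb s
    push_cast
    linear_combination Real.exp (s ^ 2 / (4 * b)) * h +
      Real.exp (s ^ 2 / (4 * b)) * s *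
        (∫ y in Set.Ioi (0 : ℝ), Real.exp (-b * y ^ 2) * Real.sin (s * y)) *
          mul_inv_cancel₀ hb.ne'
  rw [intervalIntegral.integral_eq_sub_of_hasDerivAt (fun s _ => hderiv s)
    (Continuous.intervalIntegrable (by fun_prop) _ _), Real.exp_neg]
  generalize (∫ y in Set.Ioi (0 : ℝ), Real.exp (-b * y ^ 2) * Real.sin (t * y)) = S
  simp
  field_simp

theorem integral_gaussian_sin_eq (a : ℝ) (ha : 0 < a) :
    ∫ y in Set.Ioi (0 : ℝ), Real.exp (-y ^ 2 / (4 * a ^ 2)) * Real.sin y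
      = 2 * a * Real.exp (-a ^ 2) * ∫ w in (0 : ℝ)..a, Real.exp (w ^ 2) := by
  have hscale : a * ∫ s in (0 : ℝ)..1, Real.exp ((a * s) ^ 2)
      = ∫ w in (0 : ℝ)..a, Real.exp (w ^ 2) := by
    simpa using intervalIntegral.mul_integral_comp_mul_left (a := 0) (b := 1)
      (f := fun w : ℝ => Real.exp (w ^ 2)) a
  have h := integral_exp_neg_mul_sq_mul_sin (b := 1 / (4 * a ^ 2)) (by positivity) 1
  have hl (y : ℝ) : -(1 / (4 * a ^ 2)) * y ^ 2 = -y ^ 2 / (4 * a ^ 2) := by ring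
  have hr (s : ℝ) : s ^ 2 / (4 * (1 / (4 * a ^ 2))) = (a * s) ^ 2 := by field_simp
  simp only [hl, hr, one_mul, mul_one] at h
  rw [h, ← hscale]
  field_simp
  ring
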